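/- arXiv:1106.1768 — 4 statements merged into one kernel-verified Lean document; each statement's English description precedes it below -/
import Mathlib

section
/- Let f : (0,∞) → (0,∞) be differentiable, let c ∈ ℝ, c ≠ 0, and set g(x) = f(x^c) / (f(x))^c. Suppose the function h(x) = log f(e^x) is concave on ℝ. Then: g is monotone increasing on (1,∞) if c ∈ (0,1); g is monotone increasing on (0,1) if c > 1; g is monotone increasing on (0,1) if c < 0; g is monotone decreasing on (0,1) if c ∈ (0,1); g is monotone decreasing on (1,∞) if c > 1; and g is monotone decreasing on (1,∞) if c < 0. -/
/-- If `h` has antitone derivative, the derivative of `t ↦ h (c * t) - c * h t` has the opposite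
sign to `c * (c - 1) * t`. -/
lemma mul_deriv_sub_nonneg {h : ℝ → ℝ} (hh : Antitone (deriv h)) {c t : ℝ}
    (hct : c * ((c - 1) * t) ≤ 0) : 0 ≤ c * (deriv h (c * t) - deriv h t) := by
  rcases lt_trichotomy c 0 with hc | rfl | hc
  · have : t ≤ c * t := by nlinarith [nonneg_of_mul_nonpos_right hct hc]
    nlinarith [hh this]
  · simp
  · have : c * t ≤ t := by nlinarith [nonpos_of_mul_nonpos_right hct hc]
    nlinarith [hh this]

lemma mul_deriv_sub_nonpos {h : ℝ → ℝ} (hh : Antitone (deriv h)) {c t : ℝ}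
    (hct : 0 ≤ c * ((c - 1) * t)) : c * (deriv h (c * t) - deriv h t) ≤ 0 := by
  rcases lt_trichotomy c 0 with hc | rfl | hc
  · have : c * t ≤ t := by nlinarith [nonpos_of_mul_nonneg_right hct hc]
    nlinarith [hh this]
  · simp
  · have : t ≤ c * t := by nlinarith [nonneg_of_mul_nonneg_right hct hc]
    nlinarith [hh this]

lemma hasDerivAt_comp_mul_sub_mul {h : ℝ → ℝ} (hd : Differentiable ℝ h) (c t : ℝ) :
    HasDerivAt (fun t => h (c * t) - c * h t) (c * (deriv h (c * t) - deriv h t)) t := by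
  have hmul : HasDerivAt (fun t : ℝ => c * t) c t := by
    simpa using (hasDerivAt_id t).const_mul c
  exact (((hd (c * t)).hasDerivAt.comp t hmul).sub
    ((hd t).hasDerivAt.const_mul c)).congr_deriv (by ring)

lemma monotoneOn_comp_mul_sub_mul {h : ℝ → ℝ} (hd : Differentiable ℝ h)
    (hh : Antitone (deriv h)) {c : ℝ} {s : Set ℝ} (hs : Convex ℝ s)
    (hcs : ∀ t ∈ s, c * ((c - 1) * t) ≤ 0) :
    MonotoneOn (fun t => h (c * t) - c * h t) s := by
  have key := hasDerivAt_comp_mul_sub_mul hd c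
  refine monotoneOn_of_deriv_nonneg hs (fun t _ => (key t).continuousAt.continuousWithinAt)
    (fun t _ => (key t).differentiableAt.differentiableWithinAt) fun t ht => ?_
  rw [(key t).deriv]
  exact mul_deriv_sub_nonneg hh (hcs t (interior_subset ht))

lemma antitoneOn_comp_mul_sub_mul {h : ℝ → ℝ} (hd : Differentiable ℝ h)
    (hh : Antitone (deriv h)) {c : ℝ} {s : Set ℝ} (hs : Convex ℝ s)
    (hcs : ∀ t ∈ s, 0 ≤ c * ((c - 1) * t)) :
    AntitoneOn (fun t => h (c * t) - c * h t) s := by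
  have key := hasDerivAt_comp_mul_sub_mul hd c
  refine antitoneOn_of_deriv_nonpos hs (fun t _ => (key t).continuousAt.continuousWithinAt)
    (fun t _ => (key t).differentiableAt.differentiableWithinAt) fun t ht => ?_
  rw [(key t).deriv]
  exact mul_deriv_sub_nonpos hh (hcs t (interior_subset ht))

lemma div_rpow_eq_exp_log {f : ℝ → ℝ} (hf : ∀ x, 0 < x → 0 < f x) (c : ℝ) {x : ℝ} (hx : 0 < x) :
    f (x ^ c) / f x ^ c = Real.exp (Real.log (f (Real.exp (c * Real.log x))) -
      c * Real.log (f (Real.exp (Real.log x)))) := by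
  rw [Real.exp_log hx, mul_comm c (Real.log x), ← Real.rpow_def_of_pos hx, Real.exp_sub,
    Real.exp_log (hf _ (Real.rpow_pos_of_pos hx c)), Real.rpow_def_of_pos (hf x hx),
    mul_comm c]

/-- Theorem 1.4 (2): if `f : (0,∞) → (0,∞)` is differentiable and
`h(x) = log f(e^x)` is concave on ℝ, then `g(x) = f(x^c)/(f x)^c` is
monotone increasing on `(1,∞)` for `c ∈ (0,1)`, increasing on `(0,1)` for `c > 1`
or `c < 0`, decreasing on `(0,1)` for `c ∈ (0,1)`, and decreasing on `(1,∞)`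
for `c > 1` or `c < 0`. -/
theorem monotonicity_of_ratio_concave (f : ℝ → ℝ) (c : ℝ) (hc : c ≠ 0)
    (hf_pos : ∀ x, 0 < x → 0 < f x)
    (hf_diff : DifferentiableOn ℝ f (Set.Ioi 0))
    (hconc : ConcaveOn ℝ Set.univ (fun x : ℝ => Real.log (f (Real.exp x)))) :
    ((0 < c ∧ c < 1) → MonotoneOn (fun x : ℝ => f (x ^ c) / (f x) ^ c) (Set.Ioi 1)) ∧
    (1 < c → MonotoneOn (fun x : ℝ => f (x ^ c) / (f x) ^ c) (Set.Ioo 0 1)) ∧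
    (c < 0 → MonotoneOn (fun x : ℝ => f (x ^ c) / (f x) ^ c) (Set.Ioo 0 1)) ∧
    ((0 < c ∧ c < 1) → AntitoneOn (fun x : ℝ => f (x ^ c) / (f x) ^ c) (Set.Ioo 0 1)) ∧
    (1 < c → AntitoneOn (fun x : ℝ => f (x ^ c) / (f x) ^ c) (Set.Ioi 1)) ∧
    (c < 0 → AntitoneOn (fun x : ℝ => f (x ^ c) / (f x) ^ c) (Set.Ioi 1)) := by
  set h : ℝ → ℝ := fun x => Real.log (f (Real.exp x))
  have hd : Differentiable ℝ h := fun t =>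
    ((((hf_diff _ (Real.exp_pos t)).differentiableAt (Ioi_mem_nhds (Real.exp_pos t))).comp t
      Real.differentiableAt_exp).log (hf_pos _ (Real.exp_pos t)).ne')
  have hanti : Antitone (deriv h) := by
    rw [← antitoneOn_univ]
    exact hconc.antitoneOn_deriv fun t _ => hd t
  have mono {s u : Set ℝ} (hs : ∀ x ∈ s, 0 < x ∧ Real.log x ∈ u) (hu : Convex ℝ u)
      (hcu : ∀ t ∈ u, c * ((c - 1) * t) ≤ 0) :
      MonotoneOn (fun x : ℝ => f (x ^ c) / (f x) ^ c) s := by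
    intro x hx y hy hxy
    obtain ⟨hx0, hxu⟩ := hs x hx
    obtain ⟨hy0, hyu⟩ := hs y hy
    simp only [div_rpow_eq_exp_log hf_pos c hx0, div_rpow_eq_exp_log hf_pos c hy0]
    exact Real.exp_le_exp.2
      (monotoneOn_comp_mul_sub_mul hd hanti hu hcu hxu hyu (Real.log_le_log hx0 hxy))
  have anti {s u : Set ℝ} (hs : ∀ x ∈ s, 0 < x ∧ Real.log x ∈ u) (hu : Convex ℝ u)
      (hcu : ∀ t ∈ u, 0 ≤ c * ((c - 1) * t)) :
      AntitoneOn (fun x : ℝ => f (x ^ c) / (f x) ^ c) s := by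
    intro x hx y hy hxy
    obtain ⟨hx0, hxu⟩ := hs x hx
    obtain ⟨hy0, hyu⟩ := hs y hy
    simp only [div_rpow_eq_exp_log hf_pos c hx0, div_rpow_eq_exp_log hf_pos c hy0]
    exact Real.exp_le_exp.2
      (antitoneOn_comp_mul_sub_mul hd hanti hu hcu hxu hyu (Real.log_le_log hx0 hxy))
  have hgt : ∀ x ∈ Set.Ioi (1 : ℝ), 0 < x ∧ Real.log x ∈ Set.Ioi (0 : ℝ) :=
    fun x hx => ⟨one_pos.trans hx, Real.log_pos hx⟩
  have hlt : ∀ x ∈ Set.Ioo (0 : ℝ) 1, 0 < x ∧ Real.log x ∈ Set.Iio (0 : ℝ) :=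
    fun x hx => ⟨hx.1, Real.log_neg hx.1 hx.2⟩
  have coeff_nonpos (h0 : 0 < c) (h1 : c < 1) : c * (c - 1) ≤ 0 := by nlinarith
  have coeff_nonneg_of_one_lt (h1 : 1 < c) : 0 ≤ c * (c - 1) := by nlinarith
  have coeff_nonneg_of_neg (h0 : c < 0) : 0 ≤ c * (c - 1) := by nlinarith
  simp only [← mul_assoc] at mono anti
  refine ⟨fun h1 => mono hgt (convex_Ioi 0) fun t ht => ?_,
    fun h1 => mono hlt (convex_Iio 0) fun t ht => ?_,
    fun h1 => mono hlt (convex_Iio 0) fun t ht => ?_,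
    fun h1 => anti hlt (convex_Iio 0) fun t ht => ?_,
    fun h1 => anti hgt (convex_Ioi 0) fun t ht => ?_,
    fun h1 => anti hgt (convex_Ioi 0) fun t ht => ?_⟩
  · exact mul_nonpos_of_nonpos_of_nonneg (coeff_nonpos h1.1 h1.2) (le_of_lt ht)
  · exact mul_nonpos_of_nonneg_of_nonpos (coeff_nonneg_of_one_lt h1) (le_of_lt ht)
  · exact mul_nonpos_of_nonneg_of_nonpos (coeff_nonneg_of_neg h1) (le_of_lt ht)
  · exact mul_nonneg_of_nonpos_of_nonpos (coeff_nonpos h1.1 h1.2) (le_of_lt ht)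
  · exact mul_nonneg (coeff_nonneg_of_one_lt h1) (le_of_lt ht)
  · exact mul_nonneg (coeff_nonneg_of_neg h1) (le_of_lt ht)
end

section
/- Let c, d > 0, set a₀ = cd/(c+d) and h = (cd)²/((c+d)²(c+d+1)). If (a₀ - 1)/h ≤ 1 - 1/(2·log 2), then (1/2)·F(c,d;c+d;1/2) ≤ 1. -/
/-- The Gaussian hypergeometric function `₂F₁(a,b;c;x)` defined by its Maclaurin
series `∑ (a)ₙ(b)ₙ/((c)ₙ n!) xⁿ`, where `(a)ₙ` is the rising factorial. -/
noncomputable def hypergeom (a b c x : ℝ) : ℝ :=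
  ∑' n : ℕ, ((∏ k ∈ Finset.range n, (a + k)) * (∏ k ∈ Finset.range n, (b + k)) /
      ((∏ k ∈ Finset.range n, (c + k)) * (Nat.factorial n))) * x ^ n

open Filter Topology

/-- The `n`-th Maclaurin coefficient of `hypergeom a b c`. -/
noncomputable def hypergeomCoeff (a b c : ℝ) (n : ℕ) : ℝ :=
  (∏ k ∈ Finset.range n, (a + k)) * (∏ k ∈ Finset.range n, (b + k)) /
    ((∏ k ∈ Finset.range n, (c + k)) * (Nat.factorial n))

lemma hypergeomCoeff_pos {a b c : ℝ} (ha : 0 < a) (hb : 0 < b) (hc : 0 < c) (n : ℕ) :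
    0 < hypergeomCoeff a b c n := by
  have key : ∀ {t : ℝ}, 0 < t → 0 < ∏ k ∈ Finset.range n, (t + (k : ℝ)) := fun ht =>
    Finset.prod_pos fun k _ => by positivity
  have h1 := key ha
  have h2 := key hb
  have h3 := key hc
  unfold hypergeomCoeff
  positivity

lemma hypergeomCoeff_succ {a b c : ℝ} (hc : 0 < c) (n : ℕ) :
    hypergeomCoeff a b c (n + 1) =
      hypergeomCoeff a b c n * ((a + n) / (c + n) * ((b + n) / (1 + n))) := by
  have h1 : 0 < ∏ k ∈ Finset.range n, (c + (k : ℝ)) :=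
    Finset.prod_pos fun k _ => by positivity
  have h2 : (0 : ℝ) < c + n := by positivity
  unfold hypergeomCoeff
  rw [Finset.prod_range_succ, Finset.prod_range_succ, Finset.prod_range_succ,
    Nat.factorial_succ]
  push_cast
  field_simp
  ring

lemma tendsto_hypergeomCoeff_ratio {a b c : ℝ} (ha : 0 < a) (hb : 0 < b) (hc : 0 < c) :
    Tendsto (fun n => hypergeomCoeff a b c (n + 1) / hypergeomCoeff a b c n) atTop (𝓝 1) := by
  have h1 := tendsto_add_mul_div_add_mul_atTop_nhds a c 1 (one_ne_zero (α := ℝ))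
  have h2 := tendsto_add_mul_div_add_mul_atTop_nhds b 1 1 (one_ne_zero (α := ℝ))
  have h := h1.mul h2
  simp only [one_mul, div_one] at h
  refine h.congr fun n => ?_
  rw [hypergeomCoeff_succ hc, mul_div_cancel_left₀ _ (hypergeomCoeff_pos ha hb hc n).ne']

lemma summable_hypergeomCoeff {a b c r : ℝ} (ha : 0 < a) (hb : 0 < b) (hc : 0 < c)
    (hr : 0 < r) (hr1 : r < 1) : Summable fun n => hypergeomCoeff a b c n * r ^ n := by
  have hpos := hypergeomCoeff_pos ha hb hc
  refine summable_of_ratio_test_tendsto_lt_one hr1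
    (Eventually.of_forall fun n => (mul_pos (hpos n) (pow_pos hr n)).ne') ?_
  have h := (tendsto_hypergeomCoeff_ratio ha hb hc).mul_const r
  rw [one_mul] at h
  refine h.congr fun n => ?_
  rw [Real.norm_of_nonneg (mul_pos (hpos _) (pow_pos hr _)).le,
    Real.norm_of_nonneg (mul_pos (hpos _) (pow_pos hr _)).le]
  have := (hpos n).ne'
  field_simp
  ring

lemma summable_deriv_hypergeomCoeff {a b c r : ℝ} (ha : 0 < a) (hb : 0 < b) (hc : 0 < c)
    (hr : 0 < r) (hr1 : r < 1) :
    Summable fun n : ℕ => hypergeomCoeff a b c n * (n * r ^ (n - 1)) := by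
  have hpos := hypergeomCoeff_pos ha hb hc
  rw [← summable_nat_add_iff 1]
  simp only [Nat.add_sub_cancel]
  have hp : ∀ n : ℕ, 0 < hypergeomCoeff a b c (n + 1) * (((n + 1 : ℕ) : ℝ) * r ^ n) :=
    fun n => mul_pos (hpos _) (mul_pos (by positivity) (pow_pos hr n))
  refine summable_of_ratio_test_tendsto_lt_one hr1
    (Eventually.of_forall fun n => (hp n).ne') ?_
  have h1 := tendsto_add_mul_div_add_mul_atTop_nhds 2 1 1 (one_ne_zero (α := ℝ))
  have h := (((tendsto_hypergeomCoeff_ratio ha hb hc).comp (tendsto_add_atTop_nat 1)).mul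
    h1).mul_const r
  simp only [one_mul, div_one] at h
  refine h.congr fun n => ?_
  rw [Real.norm_of_nonneg (hp _).le, Real.norm_of_nonneg (hp _).le]
  have := (hpos (n + 1)).ne'
  simp only [Function.comp]
  push_cast
  field_simp
  ring

lemma hasDerivAt_hypergeom {a b c x : ℝ} (ha : 0 < a) (hb : 0 < b) (hc : 0 < c)
    (hx : |x| < 1) :
    HasDerivAt (hypergeom a b c)
      (∑' n : ℕ, hypergeomCoeff a b c n * (n * x ^ (n - 1))) x := by
  have hpos := hypergeomCoeff_pos ha hb hc
  obtain ⟨r, hxr, hr1⟩ := exists_between hx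
  have hr : 0 < r := (abs_nonneg x).trans_lt hxr
  refine hasDerivAt_tsum_of_isPreconnected (g := fun n y => hypergeomCoeff a b c n * y ^ n)
    (g' := fun n y => hypergeomCoeff a b c n * (n * y ^ (n - 1)))
    (summable_deriv_hypergeomCoeff ha hb hc hr hr1) (t := Set.Ioo (-r) r) isOpen_Ioo
    isPreconnected_Ioo (fun n y _ => (hasDerivAt_pow n y).const_mul _) (fun n y hy => ?_)
    (y₀ := 0) ⟨by linarith, hr⟩ ?_ (abs_lt.mp hxr)
  · rw [norm_mul, norm_mul, norm_pow, Real.norm_of_nonneg (hpos n).le, Real.norm_natCast]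
    have := (hpos n).le
    have : ‖y‖ ≤ r := (abs_lt.mpr hy).le
    gcongr
  · refine summable_of_ne_finset_zero (s := {0}) fun n hn => ?_
    simp_all

/-- The logarithmic derivative of the zero-balanced hypergeometric function is bounded by
the linear Taylor polynomial of `(1 - x) F' / F` divided by `1 - x`. -/
lemma one_sub_mul_deriv_hypergeom_le {c d x : ℝ} (hc : 0 < c) (hd : 0 < d)
    (hx : 0 < x) (hx1 : x < 1) :
    (1 - x) * (∑' n : ℕ, hypergeomCoeff c d (c + d) n * (n * x ^ (n - 1))) ≤
      (c * d / (c + d) - (c * d) ^ 2 / ((c + d) ^ 2 * (c + d + 1)) * x) *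
        hypergeom c d (c + d) x := by
  have hs : 0 < c + d := add_pos hc hd
  have hpos := hypergeomCoeff_pos hc hd hs
  set f := hypergeomCoeff c d (c + d) with hf
  set h := (c * d) ^ 2 / ((c + d) ^ 2 * (c + d + 1)) with hh
  have hF : HasSum (fun n => f n * x ^ n) (hypergeom c d (c + d) x) :=
    (summable_hypergeomCoeff hc hd hs hx hx1).hasSum
  have hD := (summable_deriv_hypergeomCoeff hc hd hs hx hx1).hasSum
  set D := ∑' n : ℕ, f n * (n * x ^ (n - 1))
  set F := hypergeom c d (c + d) x
  have hD' : HasSum (fun n : ℕ => f (n + 1) * (((n + 1 : ℕ) : ℝ) * x ^ n)) D := by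
    have := (hasSum_nat_add_iff' 1).mpr hD
    simpa using this
  have hG : HasSum (fun n : ℕ => c * d / (c + d) * (f n * x ^ n)
      - f (n + 1) * (((n + 1 : ℕ) : ℝ) * x ^ n) + x * (f n * (n * x ^ (n - 1))))
      (c * d / (c + d) * F - D + x * D) :=
    ((hF.mul_left _).sub hD').add (hD.mul_left x)
  have hterm : ∀ n : ℕ, c * d / (c + d) * (f n * x ^ n)
      - f (n + 1) * (((n + 1 : ℕ) : ℝ) * x ^ n) + x * (f n * (n * x ^ (n - 1))) =
      f n * (c * d / (c + d) * n / (c + d + n)) * x ^ n := by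
    intro n
    have h1 : x * (f n * (n * x ^ (n - 1))) = f n * n * x ^ n := by
      rcases n with _ | n
      · simp
      · simp only [Nat.add_sub_cancel, pow_succ]; ring
    have h2 : (0 : ℝ) < c + d + n := by positivity
    rw [h1, hf, hypergeomCoeff_succ hs]
    push_cast
    field_simp
    ring
  simp only [hterm] at hG
  have hG' := (hasSum_nat_add_iff' 1).mpr hG
  simp only [Finset.range_one, Finset.sum_singleton, Nat.cast_zero, mul_zero, zero_div, zero_mul,
    sub_zero] at hG'
  have hle := hasSum_le (fun n => ?_) (hF.mul_left (h * x)) hG'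
  · linarith
  have h2 : (0 : ℝ) < c + d + n := by positivity
  have hxn : 0 < f n * x ^ (n + 1) := mul_pos (hpos n) (pow_pos hx _)
  have key : h ≤ (c + n) / (c + d + n) * ((d + n) / (1 + n)) *
      (c * d / (c + d) * ((n + 1 : ℕ) : ℝ) / (c + d + ((n + 1 : ℕ) : ℝ))) := by
    rw [hh, ← sub_nonneg]
    have hn : (0 : ℝ) ≤ n := n.cast_nonneg
    push_cast
    generalize (n : ℝ) = m at *
    have e : (c + m) / (c + d + m) * ((d + m) / (1 + m)) *
        (c * d / (c + d) * (m + 1) / (c + d + (m + 1))) -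
        (c * d) ^ 2 / ((c + d) ^ 2 * (c + d + 1)) =
        c * d * m * ((c + d + m) * (c + d + 1) * (c + d) - c * d * (2 * (c + d) + 1 + m)) /
        ((c + d + m) * (c + d + (m + 1)) * ((c + d) ^ 2 * (c + d + 1))) := by
      field_simp
      ring
    rw [e]
    have e2 : 0 ≤ (c + d + m) * (c + d + 1) * (c + d) - c * d * (2 * (c + d) + 1 + m) := by
      ring_nf
      positivity
    positivity
  calc h * x * (f n * x ^ n) = h * (f n * x ^ (n + 1)) := by ring
    _ ≤ _ * (f n * x ^ (n + 1)) := mul_le_mul_of_nonneg_right key hxn.le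
    _ = _ := by rw [hf, hypergeomCoeff_succ hs]; ring

lemma hypergeom_zero (a b c : ℝ) : hypergeom a b c 0 = 1 := by
  unfold hypergeom
  rw [tsum_eq_single 0 fun n hn => by simp [hn]]
  simp

lemma hypergeom_half_le_exp {c d : ℝ} (hc : 0 < c) (hd : 0 < d) :
    hypergeom c d (c + d) (1 / 2) ≤
      Real.exp ((c * d) ^ 2 / ((c + d) ^ 2 * (c + d + 1)) / 2 +
        (c * d / (c + d) - (c * d) ^ 2 / ((c + d) ^ 2 * (c + d + 1))) * Real.log 2) := by
  have hs : 0 < c + d := add_pos hc hd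
  have hineq := fun x => one_sub_mul_deriv_hypergeom_le (x := x) hc hd
  set a := c * d / (c + d)
  set h := (c * d) ^ 2 / ((c + d) ^ 2 * (c + d + 1))
  set K : ℝ → ℝ := fun x =>
    hypergeom c d (c + d) x * Real.exp (-(h * x) + (a - h) * Real.log (1 - x)) with hK
  have hder : ∀ x ∈ Set.Icc (0 : ℝ) (1 / 2), HasDerivAt K
      ((∑' n : ℕ, hypergeomCoeff c d (c + d) n * (n * x ^ (n - 1))) *
        Real.exp (-(h * x) + (a - h) * Real.log (1 - x)) + hypergeom c d (c + d) x *
        (Real.exp (-(h * x) + (a - h) * Real.log (1 - x)) *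
          (-(h * 1) + (a - h) * (-1 / (1 - x))))) x := by
    intro x hx
    have hx1 : 1 - x ≠ 0 := by linarith [hx.2]
    exact (hasDerivAt_hypergeom hc hd hs (abs_lt.mpr ⟨by linarith [hx.1], by linarith [hx.2]⟩)).mul
      (((hasDerivAt_id x).const_mul h).neg.add
        ((((hasDerivAt_id x).const_sub 1).log hx1).const_mul (a - h))).exp
  have hanti : AntitoneOn K (Set.Icc 0 (1 / 2)) := by
    refine antitoneOn_of_deriv_nonpos (convex_Icc _ _)
      (fun x hx => (hder x hx).continuousAt.continuousWithinAt)
      (fun x hx => (hder x (interior_subset hx)).differentiableAt.differentiableWithinAt)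
      fun x hx => ?_
    rw [(hder x (interior_subset hx)).deriv]
    rw [interior_Icc] at hx
    have hx1 : 0 < 1 - x := by linarith [hx.2]
    have hi := hineq x hx.1 (by linarith)
    set D := ∑' n : ℕ, hypergeomCoeff c d (c + d) n * (n * x ^ (n - 1))
    set E := Real.exp (-(h * x) + (a - h) * Real.log (1 - x))
    have hE : 0 < E := Real.exp_pos _
    have e : D * E + hypergeom c d (c + d) x *
        (E * (-(h * 1) + (a - h) * (-1 / (1 - x)))) =
        E / (1 - x) * ((1 - x) * D - (a - h * x) * hypergeom c d (c + d) x) := by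
      field_simp
      ring
    rw [e]
    exact mul_nonpos_of_nonneg_of_nonpos (by positivity) (by linarith)
  have hle := hanti (a := 0) (b := 1 / 2) (by norm_num) (by norm_num) (by norm_num)
  have hlog : Real.log (1 - 1 / 2) = -Real.log 2 := by
    rw [← Real.log_inv]; norm_num
  simp only [hK, hlog, hypergeom_zero, mul_zero, sub_zero, Real.log_one, neg_zero, add_zero,
    Real.exp_zero, mul_one] at hle
  rw [← le_div_iff₀ (Real.exp_pos _), one_div (Real.exp _), ← Real.exp_neg] at hle
  refine hle.trans_eq ?_
  congr 1
  ring

/-- Theorem 4.4 (1): for `c, d > 0`, `a₀ = cd/(c+d)` and `h = (cd)²/((c+d)²(c+d+1))`,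
if `(a₀ - 1)/h ≤ 1 - 1/(2 log 2)` then `g(1/2) = (1/2)·F(c,d;c+d;1/2) ≤ 1`. -/
theorem hypergeom_half_le_one (c d : ℝ) (hc : 0 < c) (hd : 0 < d)
    (hcond : (c * d / (c + d) - 1) / ((c * d) ^ 2 / ((c + d) ^ 2 * (c + d + 1))) ≤
      1 - 1 / (2 * Real.log 2)) :
    (1 / 2 : ℝ) * hypergeom c d (c + d) (1 / 2) ≤ 1 := by
  have hh : 0 < (c * d) ^ 2 / ((c + d) ^ 2 * (c + d + 1)) := by positivity
  have hlog : 0 < Real.log 2 := Real.log_pos one_lt_two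
  have hle := hypergeom_half_le_exp hc hd
  rw [div_le_iff₀ hh] at hcond
  set h := (c * d) ^ 2 / ((c + d) ^ 2 * (c + d + 1))
  have hexp : h / 2 + (c * d / (c + d) - h) * Real.log 2 ≤ Real.log 2 := by
    have := mul_le_mul_of_nonneg_right hcond hlog.le
    have e : (1 - 1 / (2 * Real.log 2)) * h * Real.log 2 = h * Real.log 2 - h / 2 := by
      field_simp
    linarith
  have := hle.trans (Real.exp_le_exp.mpr hexp)
  rw [Real.exp_log two_pos] at this
  linarith
end

section
/- Let c, d > 0, set a₀ = cd/(c+d) and h = (cd)²/((c+d)²(c+d+1)). If (a₀ - 1)/h ≥ 1/(log 2) - 1, then (1/2)·F(c,d;c+d;1/2) ≥ 1. -/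
/-- The `n`-th Maclaurin coefficient of `₂F₁(c,d;c+d;x)`, as a function of `p = cd` and
`s = c + d`. -/
noncomputable def zeroBalancedCoeff (s p : ℝ) (n : ℕ) : ℝ :=
  ∏ k ∈ Finset.range n, ((k : ℝ) ^ 2 + s * k + p) / ((s + k) * (k + 1))

theorem zeroBalancedCoeff_succ (s p : ℝ) (n : ℕ) :
    zeroBalancedCoeff s p (n + 1) =
      zeroBalancedCoeff s p n * (((n : ℝ) ^ 2 + s * n + p) / ((s + n) * (n + 1))) :=
  Finset.prod_range_succ _ n

theorem zeroBalancedCoeff_pos {s p : ℝ} (hs : 0 < s) (hp : 0 < p) (n : ℕ) :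
    0 < zeroBalancedCoeff s p n :=
  Finset.prod_pos fun k _ => by positivity

theorem zeroBalancedCoeff_mono {s p q : ℝ} (hs : 0 < s) (hp : 0 < p) (hpq : p ≤ q) (n : ℕ) :
    zeroBalancedCoeff s p n ≤ zeroBalancedCoeff s q n :=
  Finset.prod_le_prod (fun k _ => by positivity) fun k _ => by gcongr

theorem zeroBalancedCoeff_succ_sub {s : ℝ} (hs : 0 < s) (p : ℝ) (n : ℕ) :
    zeroBalancedCoeff s p (n + 1) - zeroBalancedCoeff s p n =
      zeroBalancedCoeff s p n / (s + n) * ((p - s - n) / (n + 1)) := by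
  have h1 : s + (n : ℝ) ≠ 0 := by positivity
  rw [zeroBalancedCoeff_succ]
  field_simp
  ring

theorem hypergeom_eq_tsum_zeroBalancedCoeff (c d x : ℝ) :
    hypergeom c d (c + d) x = ∑' n : ℕ, zeroBalancedCoeff (c + d) (c * d) n * x ^ n := by
  refine tsum_congr fun n => ?_
  congr 1
  rw [zeroBalancedCoeff, Finset.prod_div_distrib, ← Finset.prod_mul_distrib,
    Finset.prod_mul_distrib (f := fun k : ℕ => c + d + (k : ℝ)),
    ← Finset.prod_range_add_one_eq_factorial]
  push_cast
  congr 1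
  exact Finset.prod_congr rfl fun k _ => by ring

theorem summable_zeroBalancedCoeff_mul_half_pow {s p : ℝ} (hs : 0 < s) (hp : 0 < p) :
    Summable fun n : ℕ => zeroBalancedCoeff s p n * (1 / 2 : ℝ) ^ n := by
  refine summable_of_ratio_norm_eventually_le (r := 1 / 2) (by norm_num) ?_
  filter_upwards [Filter.eventually_ge_atTop ⌈p - s⌉₊] with n hn
  have hn' : p - s ≤ n := Nat.ceil_le.mp hn
  have hA := zeroBalancedCoeff_pos hs hp n
  have hA' := zeroBalancedCoeff_pos hs hp (n + 1)
  have hle : zeroBalancedCoeff s p (n + 1) ≤ zeroBalancedCoeff s p n := by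
    rw [← sub_nonpos, zeroBalancedCoeff_succ_sub hs]
    exact mul_nonpos_of_nonneg_of_nonpos (by positivity)
      (div_nonpos_of_nonpos_of_nonneg (by linarith) (by positivity))
  rw [Real.norm_of_nonneg (by positivity), Real.norm_of_nonneg (by positivity), pow_succ]
  have hx : (0 : ℝ) < (1 / 2) ^ n := by positivity
  nlinarith

/-- The quotients `Aₙ / (s + n)` decrease for `n ≥ 1`. -/
theorem zeroBalancedCoeff_div_le {s p : ℝ} (hs : 0 < s) (hp : 0 < p) (hps : p ≤ s + 1) (n : ℕ) :
    zeroBalancedCoeff s p (n + 1) / (s + (n + 1 : ℕ)) ≤ p / (s * (s + 1)) := by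
  induction n with
  | zero =>
    rw [zeroBalancedCoeff_succ]
    simp [zeroBalancedCoeff, div_div]
  | succ n ih =>
    refine le_trans ?_ ih
    have hA := zeroBalancedCoeff_pos hs hp (n + 1)
    rw [zeroBalancedCoeff_succ s p (n + 1), mul_div_assoc, div_eq_mul_inv _ (s + ((n + 1 : ℕ) : ℝ))]
    refine mul_le_mul_of_nonneg_left ?_ hA.le
    push_cast
    rw [div_div, ← one_div, div_le_div_iff₀ (by positivity) (by positivity)]
    have hn : (0 : ℝ) ≤ n := n.cast_nonneg
    have : (0 : ℝ) ≤ (s + (n + 1)) * (2 * (n + 1) + s + 1 - p) := by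
      apply mul_nonneg <;> linarith
    nlinarith

theorem hasSum_half_pow_succ_div_succ :
    HasSum (fun n : ℕ => (1 / 2 : ℝ) ^ (n + 1) / (n + 1)) (Real.log 2) := by
  have h := Real.hasSum_pow_div_log_of_abs_lt_one (x := 1 / 2) (by norm_num [abs_of_pos])
  have hlog : -Real.log (1 - 1 / 2) = Real.log 2 := by
    rw [show (1 - 1 / 2 : ℝ) = 2⁻¹ by norm_num, Real.log_inv, neg_neg]
  rwa [hlog] at h

theorem two_le_tsum_zeroBalancedCoeff {s p : ℝ} (hs : 0 < s) (hp : 0 < p)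
    (hps : p ≤ s + 1)
    (hpos : 0 ≤ (s + 1 - p) * (p - s) / 2 + p * ((p - s + 1) * Real.log 2 - 1)) :
    2 ≤ ∑' n : ℕ, zeroBalancedCoeff s p n * (1 / 2 : ℝ) ^ n := by
  have hsum := (summable_zeroBalancedCoeff_mul_half_pow hs hp).hasSum
  set S := ∑' n : ℕ, zeroBalancedCoeff s p n * (1 / 2 : ℝ) ^ n
  have hshift : HasSum (fun n : ℕ => zeroBalancedCoeff s p (n + 1) * (1 / 2 : ℝ) ^ (n + 1))
      (S - 1) := by
    have := (hasSum_nat_add_iff' 1).mpr hsum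
    simpa [zeroBalancedCoeff] using this
  have hdiff : HasSum (fun n : ℕ => (zeroBalancedCoeff s p (n + 1) - zeroBalancedCoeff s p n) *
      (1 / 2 : ℝ) ^ (n + 1)) (S - 1 - S * (1 / 2)) := by
    refine (hshift.sub (hsum.mul_right (1 / 2))).congr_fun fun n => ?_
    ring
  have hgeom : HasSum (fun n : ℕ => (1 / 2 : ℝ) ^ (n + 1)) 1 := by
    have := hasSum_geometric_two.mul_right (1 / 2 : ℝ)
    simpa [pow_succ] using this
  set b₁ := p / (s * (s + 1)) with hb₁
  have hlow := (((hasSum_half_pow_succ_div_succ.mul_left (p - s + 1)).sub hgeom).mul_left b₁).add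
    (hasSum_ite_eq (0 : ℕ) ((1 / s - b₁) * (p - s) / 2))
  have key := hasSum_le (fun n => ?_) hlow hdiff
  · have hE : b₁ * ((p - s + 1) * Real.log 2 - 1) + (1 / s - b₁) * (p - s) / 2 =
        ((s + 1 - p) * (p - s) / 2 + p * ((p - s + 1) * Real.log 2 - 1)) / (s * (s + 1)) := by
      rw [hb₁]
      field_simp
      ring
    rw [hE] at key
    have := key.trans' (div_nonneg hpos (by positivity))
    linarith
  · rw [zeroBalancedCoeff_succ_sub hs]
    cases n with
    | zero =>
      simp [zeroBalancedCoeff]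
      ring_nf
      exact le_rfl
    | succ n =>
      have hb := zeroBalancedCoeff_div_le hs hp hps n
      have hn : (0 : ℝ) ≤ n := n.cast_nonneg
      have hw : (p - s - (n + 1 : ℕ)) / ((n + 1 : ℕ) + 1) ≤ 0 :=
        div_nonpos_of_nonpos_of_nonneg (by push_cast; linarith) (by positivity)
      have hmul := mul_le_mul_of_nonneg_right (mul_le_mul_of_nonpos_right hb hw)
        (by positivity : (0 : ℝ) ≤ (1 / 2) ^ (n + 1 + 1))
      refine le_trans (le_of_eq ?_) hmul
      rw [if_neg (Nat.succ_ne_zero n), add_zero]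
      rw [← hb₁]
      have : ((n + 1 : ℕ) : ℝ) + 1 ≠ 0 := by positivity
      field_simp
      ring

/-- Here `a = p / s` and `L = log 2`. -/
theorem half_le_of_condition {s p L : ℝ} (hs : 0 < s) (hsp : s ≤ p) (hL : 69 / 100 < L)
    (hL' : L < 7 / 10) (h : (1 - L) * (p / s) ^ 2 ≤ L * ((p / s - 1) * (s + 1))) :
    0 ≤ (s + 1 - p) * (p - s) / 2 + p * ((p - s + 1) * L - 1) := by
  obtain ⟨e, rfl⟩ : ∃ e, p = s * (1 + e) := ⟨p / s - 1, by field_simp; ring⟩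
  have he : 0 ≤ e := by
    by_contra! hlt
    nlinarith
  rw [mul_div_cancel_left₀ _ hs.ne'] at h
  have hcoef : 0 ≤ 1 - L + (2 * L - 1) * (2 - 3 * L) := by nlinarith
  have h1 : (1 - L) * (1 + e) ^ 2 ≤ L * (e * (s + 1)) := by linarith
  have h2 := mul_le_mul_of_nonneg_left h1
    (by nlinarith : (0 : ℝ) ≤ 1 + (1 + e) * (2 * L - 1))
  have h3 := mul_nonneg he hcoef
  have h4 : 0 ≤ (2 * L - 1) * (1 - L) * e ^ 2 :=
    mul_nonneg (mul_nonneg (by linarith) (by linarith)) (sq_nonneg e)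
  have h5 := mul_nonneg (by linarith : (0 : ℝ) ≤ 1 + e) (add_nonneg h3 h4)
  have h6 : 0 ≤ L * (e * (s + 1) + (1 + e) * (s * e * (2 * L - 1) - (2 - 2 * L))) := by
    nlinarith
  have h7 : 0 ≤ e * (s + 1) + (1 + e) * (s * e * (2 * L - 1) - (2 - 2 * L)) :=
    nonneg_of_mul_nonneg_right h6 (by linarith)
  have h8 := mul_nonneg hs.le h7
  nlinarith

/-- Theorem 4.4 (2): for `c, d > 0`, `a₀ = cd/(c+d)` and `h = (cd)²/((c+d)²(c+d+1))`,
if `(a₀ - 1)/h ≥ 1/log 2 - 1` then `g(1/2) = (1/2)·F(c,d;c+d;1/2) ≥ 1`. -/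
theorem hypergeom_half_ge_one (c d : ℝ) (hc : 0 < c) (hd : 0 < d)
    (hcond : (c * d / (c + d) - 1) / ((c * d) ^ 2 / ((c + d) ^ 2 * (c + d + 1))) ≥
      1 / Real.log 2 - 1) :
    (1 / 2 : ℝ) * hypergeom c d (c + d) (1 / 2) ≥ 1 := by
  have hs : 0 < c + d := by positivity
  have hp : 0 < c * d := by positivity
  rw [hypergeom_eq_tsum_zeroBalancedCoeff]
  generalize c + d = s at *
  generalize c * d = p at *
  have hL : 69 / 100 < Real.log 2 := by linarith [Real.log_two_gt_d9]
  have hL' : Real.log 2 < 7 / 10 := by linarith [Real.log_two_lt_d9]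
  generalize hlog : Real.log 2 = L at *
  have hL0 : 0 < L := by linarith
  have h : (1 - L) * (p / s) ^ 2 ≤ L * ((p / s - 1) * (s + 1)) := by
    rw [ge_iff_le, le_div_iff₀ (by positivity)] at hcond
    have := mul_le_mul_of_nonneg_left hcond (by positivity : 0 ≤ L * (s + 1))
    calc (1 - L) * (p / s) ^ 2
        = L * (s + 1) * ((1 / L - 1) * (p ^ 2 / (s ^ 2 * (s + 1)))) := by field_simp
      _ ≤ _ := this
      _ = _ := by ring
  have hsp : s ≤ p := by
    have h0 : 0 ≤ (1 - L) * (p / s) ^ 2 := mul_nonneg (by linarith) (sq_nonneg _)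
    have h1 : 0 ≤ (p / s - 1) * (s + 1) := nonneg_of_mul_nonneg_right (h0.trans h) hL0
    have h2 : 0 ≤ p / s - 1 := nonneg_of_mul_nonneg_left h1 (by linarith)
    rwa [sub_nonneg, one_le_div₀ hs] at h2
  suffices 2 ≤ ∑' n : ℕ, zeroBalancedCoeff s p n * (1 / 2 : ℝ) ^ n by linarith
  rcases le_total p (s + 1) with hps | hps
  · refine two_le_tsum_zeroBalancedCoeff hs hp hps ?_
    rw [hlog]
    exact half_le_of_condition hs hsp hL hL' h
  · have hs1 : 0 < s + 1 := by linarith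
    refine (two_le_tsum_zeroBalancedCoeff hs hs1 le_rfl ?_).trans
      (Summable.tsum_le_tsum (fun n => ?_) (summable_zeroBalancedCoeff_mul_half_pow hs hs1)
        (summable_zeroBalancedCoeff_mul_half_pow hs hp))
    · rw [hlog]
      nlinarith
    · exact mul_le_mul_of_nonneg_right (zeroBalancedCoeff_mono hs hs1 hps n) (by positivity)
end

section
/- Let 0 < a ≤ 1 ≤ b, define φ(s) = max{s^a, s^b} for s > 0, and let c, d > 0 with c·d ≤ 1. Define g(x) = x·F(c,d;c+d;x) for x ∈ (0,1). Then for every s > 0, g( φ(s)/(1+φ(s)) ) ≤ (b/a) · max{ ( g(s/(1+s)) )^a , g(s/(1+s)) }. -/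
/-- The ratio of the `n`-th Maclaurin coefficients of `x F(c,d;c+d;x)` and `-log (1 - x)`. -/
noncomputable def hypergeomLogRatio (c d : ℝ) (n : ℕ) : ℝ :=
  ((∏ k ∈ Finset.range n, (c + k)) * (∏ k ∈ Finset.range n, (d + k)) /
      ((∏ k ∈ Finset.range n, (c + d + k)) * (Nat.factorial n))) * (n + 1)

lemma hypergeomLogRatio_zero (c d : ℝ) : hypergeomLogRatio c d 0 = 1 := by
  simp [hypergeomLogRatio]

lemma hypergeomLogRatio_pos {c d : ℝ} (hc : 0 < c) (hd : 0 < d) (n : ℕ) :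
    0 < hypergeomLogRatio c d n := by
  have h : ∀ e : ℝ, 0 < e → 0 < ∏ k ∈ Finset.range n, (e + k) := fun e he =>
    Finset.prod_pos fun k _ => by positivity
  have h1 := h c hc
  have h2 := h d hd
  have h3 := h (c + d) (by positivity)
  unfold hypergeomLogRatio
  positivity

lemma hypergeomLogRatio_succ {c d : ℝ} (hc : 0 < c) (hd : 0 < d) (n : ℕ) :
    hypergeomLogRatio c d (n + 1) = hypergeomLogRatio c d n *
      ((c + n) * (d + n) * (n + 2) / ((c + d + n) * (n + 1) ^ 2)) := by
  have h3 : (∏ k ∈ Finset.range n, (c + d + k)) ≠ 0 :=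
    (Finset.prod_pos fun k _ => by positivity).ne'
  have h4 : c + d + n ≠ 0 := by positivity
  unfold hypergeomLogRatio
  simp only [Finset.prod_range_succ, Nat.factorial_succ]
  push_cast
  field_simp
  ring

lemma hypergeomLogRatio_antitone {c d : ℝ} (hc : 0 < c) (hd : 0 < d) (hcd : c * d ≤ 1) :
    Antitone (hypergeomLogRatio c d) := by
  refine antitone_nat_of_succ_le fun n => ?_
  rw [hypergeomLogRatio_succ hc hd]
  refine mul_le_of_le_one_right (hypergeomLogRatio_pos hc hd n).le ?_
  rw [div_le_one (by positivity)]
  have h2 : 2 * (c * d) ≤ c + d := by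
    refine abs_le_of_sq_le_sq' ?_ (by positivity) |>.2
    nlinarith [sq_nonneg (c - d), mul_pos hc hd]
  have hn : (0 : ℝ) ≤ n := n.cast_nonneg
  nlinarith [mul_nonneg hn (sub_nonneg.2 hcd)]

lemma hypergeomLogRatio_le_one {c d : ℝ} (hc : 0 < c) (hd : 0 < d) (hcd : c * d ≤ 1) (n : ℕ) :
    hypergeomLogRatio c d n ≤ 1 :=
  hypergeomLogRatio_zero c d ▸ hypergeomLogRatio_antitone hc hd hcd n.zero_le

lemma hasSum_mul_hypergeom {c d x : ℝ} (hc : 0 < c) (hd : 0 < d) (hcd : c * d ≤ 1)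
    (hx : 0 < x) (hx1 : x < 1) :
    HasSum (fun n : ℕ => hypergeomLogRatio c d n * (x ^ (n + 1) / (n + 1)))
      (x * hypergeom c d (c + d) x) := by
  have hL := Real.hasSum_pow_div_log_of_abs_lt_one (abs_lt.2 ⟨by linarith, hx1⟩)
  have hs : Summable fun n : ℕ => hypergeomLogRatio c d n * (x ^ (n + 1) / (n + 1)) :=
    Summable.of_nonneg_of_le
      (fun n => mul_nonneg (hypergeomLogRatio_pos hc hd n).le (by positivity))
      (fun n => mul_le_of_le_one_left (by positivity) (hypergeomLogRatio_le_one hc hd hcd n))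
      hL.summable
  convert hs.hasSum using 1
  rw [hypergeom, ← tsum_mul_left]
  refine tsum_congr fun n => ?_
  have : (n : ℝ) + 1 ≠ 0 := by positivity
  rw [hypergeomLogRatio, pow_succ]
  generalize (∏ k ∈ Finset.range n, (c + (k : ℝ))) * (∏ k ∈ Finset.range n, (d + (k : ℝ))) /
      ((∏ k ∈ Finset.range n, (c + d + (k : ℝ))) * (Nat.factorial n)) = q
  field_simp

lemma mul_hypergeom_pos {c d x : ℝ} (hc : 0 < c) (hd : 0 < d) (hcd : c * d ≤ 1)
    (hx : 0 < x) (hx1 : x < 1) : 0 < x * hypergeom c d (c + d) x := by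
  have h := hasSum_mul_hypergeom hc hd hcd hx hx1
  have hp : ∀ n : ℕ, 0 < hypergeomLogRatio c d n * (x ^ (n + 1) / (n + 1)) := fun n =>
    mul_pos (hypergeomLogRatio_pos hc hd n) (by positivity)
  exact h.tsum_eq ▸ h.summable.tsum_pos (fun n => (hp n).le) 0 (hp 0)

lemma mul_hypergeom_le_neg_log {c d x : ℝ} (hc : 0 < c) (hd : 0 < d) (hcd : c * d ≤ 1)
    (hx : 0 < x) (hx1 : x < 1) : x * hypergeom c d (c + d) x ≤ -Real.log (1 - x) :=
  hasSum_le
    (fun n => mul_le_of_le_one_left (by positivity) (hypergeomLogRatio_le_one hc hd hcd n))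
    (hasSum_mul_hypergeom hc hd hcd hx hx1)
    (Real.hasSum_pow_div_log_of_abs_lt_one (abs_lt.2 ⟨by linarith, hx1⟩))

/-- A weighted Chebyshev sum inequality. -/
lemma sum_mul_sum_le_of_antitone {A u v : ℕ → ℝ} (hA : Antitone A)
    (huv : ∀ m n, m ≤ n → v m * u n ≤ u m * v n) (s : Finset ℕ) :
    (∑ n ∈ s, A n * v n) * ∑ n ∈ s, u n ≤ (∑ n ∈ s, A n * u n) * ∑ n ∈ s, v n := by
  have h0 : 0 ≤ ∑ m ∈ s, ∑ n ∈ s, (A m - A n) * (u m * v n - v m * u n) := by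
    refine Finset.sum_nonneg fun m _ => Finset.sum_nonneg fun n _ => ?_
    rcases le_total m n with h | h
    · exact mul_nonneg (sub_nonneg.2 (hA h)) (sub_nonneg.2 (huv m n h))
    · exact mul_nonneg_of_nonpos_of_nonpos (sub_nonpos.2 (hA h))
        (by linarith [huv n m h, mul_comm (u n) (v m), mul_comm (v n) (u m)])
  have h1 : ∑ m ∈ s, ∑ n ∈ s, (A m - A n) * (u m * v n - v m * u n) =
      2 * ((∑ n ∈ s, A n * u n) * ∑ n ∈ s, v n - (∑ n ∈ s, A n * v n) * ∑ n ∈ s, u n) := by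
    have e : ∀ m n, (A m - A n) * (u m * v n - v m * u n) =
        ((A m * u m) * v n - (A m * v m) * u n) +
          (v m * (A n * u n) * (1 : ℝ) - u m * (A n * v n)) := fun m n => by ring
    simp only [e, mul_one, Finset.sum_add_distrib, Finset.sum_sub_distrib, ← Finset.sum_mul_sum]
    ring
  linarith

/-- `x F(c,d;c+d;x) / (-log (1 - x))` is decreasing on `(0,1)`, in product form. -/
lemma mul_hypergeom_mul_log_le {c d x y : ℝ} (hc : 0 < c) (hd : 0 < d) (hcd : c * d ≤ 1)
    (hx : 0 < x) (hxy : x ≤ y) (hy1 : y < 1) :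
    y * hypergeom c d (c + d) y * -Real.log (1 - x) ≤
      x * hypergeom c d (c + d) x * -Real.log (1 - y) := by
  have hy : 0 < y := hx.trans_le hxy
  have hx1 : x < 1 := hxy.trans_lt hy1
  have hLx := Real.hasSum_pow_div_log_of_abs_lt_one (abs_lt.2 ⟨by linarith, hx1⟩)
  have hLy := Real.hasSum_pow_div_log_of_abs_lt_one (abs_lt.2 ⟨by linarith, hy1⟩)
  refine le_of_tendsto_of_tendsto'
    ((hasSum_mul_hypergeom hc hd hcd hy hy1).tendsto_sum_nat.mul hLx.tendsto_sum_nat)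
    ((hasSum_mul_hypergeom hc hd hcd hx hx1).tendsto_sum_nat.mul hLy.tendsto_sum_nat)
    fun N => sum_mul_sum_le_of_antitone (hypergeomLogRatio_antitone hc hd hcd)
      (fun m n hmn => ?_) _
  obtain ⟨k, rfl⟩ := Nat.exists_eq_add_of_le hmn
  rw [div_mul_div_comm, div_mul_div_comm]
  refine div_le_div_of_nonneg_right ?_ (by positivity)
  have hk : x ^ k ≤ y ^ k := pow_le_pow_left₀ hx.le hxy k
  calc y ^ (m + 1) * x ^ (m + k + 1) = (x ^ (m + 1) * y ^ (m + 1)) * x ^ k := by ring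
    _ ≤ (x ^ (m + 1) * y ^ (m + 1)) * y ^ k := by gcongr
    _ = x ^ (m + 1) * y ^ (m + k + 1) := by ring

lemma log_one_add_rpow_le_mul {b s : ℝ} (hb : 1 ≤ b) (hs : 0 < s) :
    Real.log (1 + s ^ b) ≤ b * Real.log (1 + s) := by
  rw [← Real.log_rpow (by positivity)]
  refine Real.log_le_log (by positivity) ?_
  simpa using Real.add_rpow_le_rpow_add zero_le_one hs.le hb

lemma mul_log_one_add_le {s t : ℝ} (hs : 0 < s) (hst : s ≤ t) :
    s * Real.log (1 + t) ≤ t * Real.log (1 + s) := by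
  have h1 : 1 ≤ t / s := (one_le_div hs).2 hst
  have h : 1 + t ≤ (1 + s) ^ (t / s) := by
    have := one_add_mul_self_le_rpow_one_add (s := s) (by linarith) h1
    rwa [div_mul_cancel₀ _ hs.ne'] at this
  have h2 := Real.log_le_log (by linarith) h
  rw [Real.log_rpow (by positivity)] at h2
  calc s * Real.log (1 + t) ≤ s * (t / s * Real.log (1 + s)) := by gcongr
    _ = t * Real.log (1 + s) := by field_simp

lemma log_one_add_rpow_le_rpow_log {a s : ℝ} (ha1 : a ≤ 1) (hs : 0 < s)
    (hs1 : s ≤ 1) : Real.log (1 + s ^ a) ≤ Real.log (1 + s) ^ a := by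
  have hL : 0 < Real.log (1 + s) := Real.log_pos (by linarith)
  have hle : s ≤ s ^ a := by
    simpa using Real.rpow_le_rpow_of_exponent_ge hs hs1 ha1
  have hLs : Real.log (1 + s) / s ≤ 1 := by
    rw [div_le_one hs]
    linarith [Real.log_le_sub_one_of_pos (show 0 < 1 + s by positivity)]
  have hpow : Real.log (1 + s) / s ≤ (Real.log (1 + s) / s) ^ a := by
    simpa using Real.rpow_le_rpow_of_exponent_ge (div_pos hL hs) hLs ha1
  calc Real.log (1 + s ^ a) ≤ s ^ a * (Real.log (1 + s) / s) := by
        rw [← mul_div_assoc, le_div_iff₀ hs, mul_comm]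
        exact mul_log_one_add_le hs hle
    _ ≤ s ^ a * (Real.log (1 + s) / s) ^ a := by gcongr
    _ = Real.log (1 + s) ^ a := by
        rw [← Real.mul_rpow hs.le (div_pos hL hs).le, mul_div_cancel₀ _ hs.ne']

lemma neg_log_one_sub_div_one_add {s : ℝ} (hs : 0 < s) :
    -Real.log (1 - s / (1 + s)) = Real.log (1 + s) := by
  rw [← Real.log_inv]
  congr 1
  field_simp
  ring

/-- Theorem 4.10: for `0 < a ≤ 1 ≤ b`, `φ(s) = max {s^a, s^b}`, and `c, d > 0` with
`cd ≤ 1`, setting `g(x) = x·F(c,d;c+d;x)`, the inequality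
`g(φ(s)/(1+φ(s))) ≤ (b/a)·max{ g(s/(1+s))^a , g(s/(1+s)) }` holds for each `s > 0`. -/
theorem hypergeom_bernoulli_type (a b c d : ℝ) (ha : 0 < a) (ha1 : a ≤ 1) (hb : 1 ≤ b)
    (hc : 0 < c) (hd : 0 < d) (hcd : c * d ≤ 1) (s : ℝ) (hs : 0 < s) :
    max (s ^ a) (s ^ b) / (1 + max (s ^ a) (s ^ b)) *
        hypergeom c d (c + d) (max (s ^ a) (s ^ b) / (1 + max (s ^ a) (s ^ b))) ≤
      b / a * max ((s / (1 + s) * hypergeom c d (c + d) (s / (1 + s))) ^ a)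
        (s / (1 + s) * hypergeom c d (c + d) (s / (1 + s))) := by
  have hle : s ≤ max (s ^ a) (s ^ b) := by
    rcases le_total s 1 with h | h
    · exact le_max_of_le_left (by simpa using Real.rpow_le_rpow_of_exponent_ge hs h ha1)
    · exact le_max_of_le_right (by simpa using Real.rpow_le_rpow_of_exponent_le h hb)
  have hmax : max (s ^ a) (s ^ b) = if s ≤ 1 then s ^ a else s ^ b := by
    split_ifs with h
    · exact max_eq_left (Real.rpow_le_rpow_of_exponent_ge hs h (ha1.trans hb))
    · exact max_eq_right (Real.rpow_le_rpow_of_exponent_le (not_le.1 h).le (ha1.trans hb))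
  set φ := max (s ^ a) (s ^ b)
  have hφ : 0 < φ := hs.trans_le hle
  have hx : 0 < s / (1 + s) := by positivity
  have hx1 : s / (1 + s) < 1 := by rw [div_lt_one (by positivity)]; linarith
  have hy1 : φ / (1 + φ) < 1 := by rw [div_lt_one (by positivity)]; linarith
  have hxy : s / (1 + s) ≤ φ / (1 + φ) := by
    rw [div_le_div_iff₀ (by positivity) (by positivity)]
    linarith
  have hmono := mul_hypergeom_mul_log_le hc hd hcd hx hxy hy1
  have hG := mul_hypergeom_pos hc hd hcd hx hx1
  have hGL := mul_hypergeom_le_neg_log hc hd hcd hx hx1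
  rw [neg_log_one_sub_div_one_add hs] at hmono hGL
  rw [neg_log_one_sub_div_one_add hφ] at hmono
  set G := s / (1 + s) * hypergeom c d (c + d) (s / (1 + s))
  set L := Real.log (1 + s)
  have hL : 0 < L := Real.log_pos (by linarith)
  rw [← le_div_iff₀ hL] at hmono
  refine hmono.trans ?_
  have hba : 1 ≤ b / a := (one_le_div ha).2 (ha1.trans hb)
  rcases le_or_gt s 1 with h | h
  · rw [hmax, if_pos h]
    have hpow : G / L ≤ (G / L) ^ a := by
      simpa using Real.rpow_le_rpow_of_exponent_ge (div_pos hG hL) ((div_le_one hL).2 hGL) ha1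
    calc G * Real.log (1 + s ^ a) / L = G / L * Real.log (1 + s ^ a) := by ring
      _ ≤ (G / L) ^ a * L ^ a := by
          gcongr
          · exact Real.log_nonneg (by linarith [Real.rpow_pos_of_pos hs a])
          · exact log_one_add_rpow_le_rpow_log ha1 hs h
      _ = G ^ a := by
          rw [← Real.mul_rpow (div_pos hG hL).le hL.le, div_mul_cancel₀ _ hL.ne']
      _ ≤ max (G ^ a) G := le_max_left _ _
      _ ≤ b / a * max (G ^ a) G :=
          le_mul_of_one_le_left (hG.le.trans (le_max_right _ _)) hba
  · rw [hmax, if_neg h.not_ge]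
    calc G * Real.log (1 + s ^ b) / L ≤ G * (b * L) / L := by
          gcongr
          exact log_one_add_rpow_le_mul hb hs
      _ = b * G := by field_simp
      _ ≤ b / a * max (G ^ a) G := by
          gcongr
          · exact le_div_self (by linarith) ha ha1
          · exact le_max_right _ _
end
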